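/- Let G be a connected affine algebraic group and H ⊆ G a closed subgroup. Then the following are equivalent: (1) H is observable in G; (2) E_G(H) = X(H), i.e. every rational character of H extends to a semiinvariant regular function on G; (3) E_G(H) is a group, i.e. for every extendible character χ ∈ E_G(H) the inverse character χ^{-1} is also extendible. -/

import Mathlib

open MvPolynomial

namespace AlgebraicMonoid

variable (k : Type) [Field k] [IsAlgClosed k] (n : ℕ)

/-- `n × n` matrices over `k`: the ambient affine space for linear algebraic monoids. -/
abbrev Mat := Matrix (Fin n) (Fin n) k

/-- Polynomial functions on the space of `n × n` matrices. -/
abbrev MPoly := MvPolynomial (Fin n × Fin n) k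

variable {k n}

/-- Evaluation of a polynomial at a matrix. -/
noncomputable def mEval (x : Mat k n) (p : MPoly k n) : k :=
  eval (fun ij => x ij.1 ij.2) p

/-- The (regular function induced by) `p` vanishes identically on `X`. -/
def VanishesOn (X : Set (Mat k n)) (p : MPoly k n) : Prop :=
  ∀ x ∈ X, mEval x p = 0

/-- Zariski closed subsets of matrix space. -/
def ZClosed (X : Set (Mat k n)) : Prop :=
  ∃ S : Set (MPoly k n), X = {x | ∀ p ∈ S, mEval x p = 0}

/-- An affine (linear) algebraic monoid, realized as a Zariski closed submonoid of
matrix space (every affine algebraic monoid admits such a closed embedding). -/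
structure IsAlgMonoid (M : Set (Mat k n)) : Prop where
  zclosed : ZClosed M
  one_mem : (1 : Mat k n) ∈ M
  mul_mem : ∀ a ∈ M, ∀ b ∈ M, a * b ∈ M

/-- The unit group `G(M)` of the monoid `M`. -/
def unitGroup (M : Set (Mat k n)) : Set (Mat k n) :=
  {g | g ∈ M ∧ ∃ h ∈ M, g * h = 1 ∧ h * g = 1}

/-- `H` is an (abstract) subgroup of `G`. -/
def IsSubgroupOf (H G : Set (Mat k n)) : Prop :=
  H ⊆ G ∧ (1 : Mat k n) ∈ H ∧ (∀ a ∈ H, ∀ b ∈ H, a * b ∈ H) ∧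
    ∀ a ∈ H, ∃ b ∈ H, a * b = 1 ∧ b * a = 1

/-- `Y` is closed in `X` (for the Zariski topology). -/
def IsClosedIn (Y X : Set (Mat k n)) : Prop :=
  Y ⊆ X ∧ ∃ C : Set (Mat k n), ZClosed C ∧ Y = C ∩ X

/-- `X` is irreducible: nonempty, and its vanishing ideal is prime. -/
def IrreducibleSet (X : Set (Mat k n)) : Prop :=
  X.Nonempty ∧ ∀ p q : MPoly k n, VanishesOn X (p * q) → VanishesOn X p ∨ VanishesOn X q

/-- The action of `H` on `M` by left multiplication is observable: every nonzero
`H`-stable ideal of `k[M]` (presented as an ideal of the polynomial ring containing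
the vanishing ideal of `M`) contains a nonzero `H`-invariant function.
Here `H` acts on `k[M]` by `(f · h)(m) = f (h * m)`. -/
def LeftObservable (H M : Set (Mat k n)) : Prop :=
  ∀ J : Ideal (MPoly k n),
    (∀ p : MPoly k n, VanishesOn M p → p ∈ J) →
    (∀ p ∈ J, ∀ h ∈ H, ∃ p' ∈ J, ∀ m ∈ M, mEval m p' = mEval (h * m) p) →
    (∃ p ∈ J, ¬ VanishesOn M p) →
    ∃ p ∈ J, (¬ VanishesOn M p) ∧ ∀ h ∈ H, ∀ m ∈ M, mEval (h * m) p = mEval m p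

/-- `χ` defines a character of (the monoid) `X`, i.e. a regular multiplicative map to `k`. -/
structure IsCharacterOn (X : Set (Mat k n)) (χ : MPoly k n) : Prop where
  map_one : mEval 1 χ = 1
  map_mul : ∀ a ∈ X, ∀ b ∈ X, mEval (a * b) χ = mEval a χ * mEval b χ

/-- The character `χ` of `H` is extendible to `M`: there is a nonzero
`H`-semiinvariant `f ∈ k[M]` of weight `χ`, i.e. `f(h m) = χ(h) f(m)`. -/
def Extendible (M H : Set (Mat k n)) (χ : MPoly k n) : Prop :=
  ∃ f : MPoly k n, (¬ VanishesOn M f) ∧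
    ∀ h ∈ H, ∀ m ∈ M, mEval (h * m) f = mEval h χ * mEval m f

/-- The matrix of regular functions `P` evaluated at `x`: a rational representation. -/
noncomputable def repApply {d : ℕ} (P : Matrix (Fin d) (Fin d) (MPoly k n)) (x : Mat k n) :
    Matrix (Fin d) (Fin d) k :=
  Matrix.of fun i j => mEval x (P i j)

/-- `P` defines a (finite dimensional rational) right `M`-module structure on `k^d`,
the action being `v · x = v ᵥ* (P x)`. -/
def IsRightRep {d : ℕ} (M : Set (Mat k n)) (P : Matrix (Fin d) (Fin d) (MPoly k n)) : Prop :=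
  repApply P 1 = 1 ∧ ∀ a ∈ M, ∀ b ∈ M, repApply P (a * b) = repApply P a * repApply P b


/-- `G` is a (linear) algebraic group, realized as a Zariski closed subset of matrix
space which is a submonoid all of whose elements are invertible within it.  (Every
affine algebraic group admits such a closed embedding.) -/
def IsAlgGroup {k : Type} [Field k] {n : ℕ} (G : Set (Mat k n)) : Prop :=
  ZClosed G ∧ (1 : Mat k n) ∈ G ∧ (∀ a ∈ G, ∀ b ∈ G, a * b ∈ G) ∧
    ∀ a ∈ G, ∃ b ∈ G, a * b = 1 ∧ b * a = 1

section Evaluation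

variable {k : Type} [Field k] {n : ℕ}

@[simp] lemma mEval_add (x : Mat k n) (p q : MPoly k n) :
    mEval x (p + q) = mEval x p + mEval x q := map_add _ p q

@[simp] lemma mEval_sub (x : Mat k n) (p q : MPoly k n) :
    mEval x (p - q) = mEval x p - mEval x q := map_sub _ p q

@[simp] lemma mEval_mul (x : Mat k n) (p q : MPoly k n) :
    mEval x (p * q) = mEval x p * mEval x q := map_mul _ p q

@[simp] lemma mEval_one (x : Mat k n) : mEval x 1 = 1 := map_one (eval _)

@[simp] lemma mEval_C (x : Mat k n) (c : k) : mEval x (C c) = c := eval_C c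

@[simp] lemma mEval_smul (x : Mat k n) (c : k) (p : MPoly k n) :
    mEval x (c • p) = c * mEval x p := smul_eval _ p c

lemma mEval_det {ι : Type*} [Fintype ι] [DecidableEq ι] (x : Mat k n)
    (P : Matrix ι ι (MPoly k n)) : mEval x P.det = (P.map (mEval x)).det :=
  RingHom.map_det (eval fun ij : Fin n × Fin n => x ij.1 ij.2) P

/-- Evaluation at a matrix, as a linear functional. -/
noncomputable def evalLinear (x : Mat k n) : MPoly k n →ₗ[k] k where
  toFun := mEval x
  map_add' := mEval_add x
  map_smul' := mEval_smul x

@[simp] lemma evalLinear_apply (x : Mat k n) (p : MPoly k n) :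
    evalLinear x p = mEval x p := rfl

/-- The function induced on `X` by a polynomial. -/
noncomputable def restrictTo (X : Set (Mat k n)) : MPoly k n →ₗ[k] (X → k) :=
  LinearMap.pi fun x => evalLinear x.1

@[simp] lemma restrictTo_apply (X : Set (Mat k n)) (p : MPoly k n) (x : X) :
    restrictTo X p x = mEval x.1 p := rfl

/-- The polynomial `x ↦ p (a * x)`. -/
noncomputable def leftTranslate (a : Mat k n) : MPoly k n →ₐ[k] MPoly k n :=
  aeval fun ij => ∑ l, C (a ij.1 l) * X (l, ij.2)

/-- The polynomial `x ↦ p (x * a)`. -/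
noncomputable def rightTranslate (a : Mat k n) : MPoly k n →ₐ[k] MPoly k n :=
  aeval fun ij => ∑ l, X (ij.1, l) * C (a l ij.2)

@[simp] lemma mEval_leftTranslate (a x : Mat k n) (p : MPoly k n) :
    mEval x (leftTranslate a p) = mEval (a * x) p := by
  induction p using MvPolynomial.induction_on with
  | C c => simp [leftTranslate, MvPolynomial.algebraMap_eq]
  | add p q hp hq => simp [hp, hq]
  | mul_X p ij hp =>
    simp only [map_mul, mEval_mul, hp]
    simp [leftTranslate, mEval, Matrix.mul_apply]

@[simp] lemma mEval_rightTranslate (a x : Mat k n) (p : MPoly k n) :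
    mEval x (rightTranslate a p) = mEval (x * a) p := by
  induction p using MvPolynomial.induction_on with
  | C c => simp [rightTranslate, MvPolynomial.algebraMap_eq]
  | add p q hp hq => simp [hp, hq]
  | mul_X p ij hp =>
    simp only [map_mul, mEval_mul, hp]
    simp [rightTranslate, mEval, Matrix.mul_apply]

/-- Translation is locally finite: the left translates of a polynomial lie in a common
finite dimensional subspace. -/
lemma exists_fg_leftTranslate_mem (p : MPoly k n) :
    ∃ U : Submodule k (MPoly k n), U.FG ∧ ∀ a : Mat k n, leftTranslate a p ∈ U := by
  induction p using MvPolynomial.induction_on with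
  | C c =>
    refine ⟨Submodule.span k {C c}, Submodule.fg_span_singleton _, fun a => ?_⟩
    simp [leftTranslate, MvPolynomial.algebraMap_eq, Submodule.mem_span_singleton_self]
  | add p q hp hq =>
    obtain ⟨U, hU, hpU⟩ := hp
    obtain ⟨V, hV, hqV⟩ := hq
    refine ⟨U ⊔ V, hU.sup hV, fun a => ?_⟩
    rw [map_add]
    exact Submodule.add_mem_sup (hpU a) (hqV a)
  | mul_X p ij hp =>
    obtain ⟨U, hU, hpU⟩ := hp
    refine ⟨U * Submodule.span k (Set.range X),
      hU.mul (Submodule.fg_span (Set.finite_range _)), fun a => ?_⟩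
    rw [map_mul]
    refine Submodule.mul_mem_mul (hpU a) ?_
    simp only [leftTranslate, aeval_X]
    refine Submodule.sum_mem _ fun l _ => ?_
    rw [← MvPolynomial.smul_eq_C_mul]
    exact Submodule.smul_mem _ _ (Submodule.subset_span ⟨_, rfl⟩)

/-- The span of the translates of `p` by elements of `H`. -/
noncomputable def translateSpan (H : Set (Mat k n)) (p : MPoly k n) :
    Submodule k (MPoly k n) :=
  Submodule.span k ((fun a => leftTranslate a p) '' H)

lemma translateSpan_fg (H : Set (Mat k n)) (p : MPoly k n) : (translateSpan H p).FG := by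
  obtain ⟨U, hU, hpU⟩ := exists_fg_leftTranslate_mem p
  have : Module.Finite k U := Module.Finite.iff_fg.2 hU
  have hle : translateSpan H p ≤ U := by
    refine Submodule.span_le.2 ?_
    rintro _ ⟨a, -, rfl⟩
    exact hpU a
  exact Module.Finite.iff_fg.1 (Submodule.finiteDimensional_of_le hle)

lemma leftTranslate_leftTranslate (a b : Mat k n) (p : MPoly k n) :
    leftTranslate a (leftTranslate b p) = leftTranslate (b * a) p := by
  induction p using MvPolynomial.induction_on with
  | C c => simp [leftTranslate, MvPolynomial.algebraMap_eq]
  | add p q hp hq => simp [hp, hq]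
  | mul_X p ij hp =>
    have hX : leftTranslate a (leftTranslate b (X ij)) = leftTranslate (b * a) (X ij) := by
      simp only [leftTranslate, aeval_X, map_sum, map_mul, algHom_C, Matrix.mul_apply,
        Finset.mul_sum, Finset.sum_mul, MvPolynomial.algebraMap_eq, mul_assoc]
      exact Finset.sum_comm
    rw [map_mul, map_mul, map_mul, hp, hX]

lemma leftTranslate_mem_translateSpan {H : Set (Mat k n)}
    (hmul : ∀ a ∈ H, ∀ b ∈ H, a * b ∈ H) {a : Mat k n} (ha : a ∈ H) {p q : MPoly k n}
    (hq : q ∈ translateSpan H p) : leftTranslate a q ∈ translateSpan H p := by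
  induction hq using Submodule.span_induction with
  | mem q hq =>
    obtain ⟨b, hb, rfl⟩ := hq
    exact Submodule.subset_span
      ⟨b * a, hmul b hb a ha, (leftTranslate_leftTranslate a b p).symm⟩
  | zero =>
    rw [map_zero]
    exact Submodule.zero_mem _
  | add q q' _ _ hq hq' =>
    rw [map_add]
    exact Submodule.add_mem _ hq hq'
  | smul c q _ hq =>
    rw [map_smul]
    exact Submodule.smul_mem _ c hq

lemma mem_translateSpan_self {H : Set (Mat k n)} (h1 : (1 : Mat k n) ∈ H) (p : MPoly k n) :
    p ∈ translateSpan H p := by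
  refine Submodule.subset_span ⟨1, h1, ?_⟩
  simp [leftTranslate, Matrix.one_apply, ite_mul, apply_ite C]

end Evaluation

section Determinants

variable {k : Type} [Field k] {n : ℕ}

/-- Linearly independent functions have a nonsingular matrix of values. -/
lemma exists_det_ne_zero {ι S : Type*} [Fintype ι] [DecidableEq ι] {v : ι → S → k}
    (hv : LinearIndependent k v) :
    ∃ g : ι → S, (Matrix.of fun i j => v i (g j)).det ≠ 0 := by
  classical
  set c : S → ι → k := fun x i => v i x with hc
  have htop : Submodule.span k (Set.range c) = ⊤ := by
    by_contra hne
    obtain ⟨f, hf, hle⟩ := Submodule.exists_le_ker_of_lt_top _ (lt_top_iff_ne_top.2 hne)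
    have hcoef := Fintype.linearIndependent_iff.1 hv (fun i => f (Pi.single i 1)) (by
      funext x
      have hx : f (c x) = 0 := hle (Submodule.subset_span ⟨x, rfl⟩)
      rw [← (Pi.basisFun k ι).sum_repr (c x), map_sum] at hx
      simpa [hc, mul_comm] using hx)
    refine hf (LinearMap.pi_ext' fun i => LinearMap.ext_ring ?_)
    simpa using hcoef i
  obtain ⟨f, hfmem, -, hind⟩ := Submodule.exists_fun_fin_finrank_span_eq k (Set.range c)
  have hcard : Fintype.card ι = Module.finrank k (Submodule.span k (Set.range c)) := by
    rw [htop, finrank_top, Module.finrank_fintype_fun_eq_card]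
  choose g hg using hfmem
  let e : ι ≃ Fin (Module.finrank k (Submodule.span k (Set.range c))) :=
    Fintype.equivFinOfCardEq hcard
  refine ⟨g ∘ e, ?_⟩
  have hcol : LinearIndependent k (Matrix.of fun i j => v i ((g ∘ e) j)).col := by
    have hfe : (Matrix.of fun i j => v i ((g ∘ e) j)).col = f ∘ e := by
      funext j
      exact hg (e j)
    rw [hfe]
    exact hind.comp _ e.injective
  exact ((Matrix.isUnit_iff_isUnit_det _).1
    (Matrix.linearIndependent_cols_iff_isUnit.1 hcol)).ne_zero

/-- The polynomial `x ↦ det (vᵢ (x * gⱼ))`. -/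
noncomputable def detTranslate {ι : Type*} [Fintype ι] [DecidableEq ι] (v : ι → MPoly k n)
    (g : ι → Mat k n) : MPoly k n :=
  (Matrix.of fun i j => rightTranslate (g j) (v i)).det

variable {ι : Type*} [Fintype ι] [DecidableEq ι]

lemma mEval_detTranslate (v : ι → MPoly k n) (g : ι → Mat k n) (x : Mat k n) :
    mEval x (detTranslate v g) = (Matrix.of fun i j => mEval (x * g j) (v i)).det := by
  rw [detTranslate, mEval_det]
  congr 1
  ext i j
  simp

lemma mEval_mul_detTranslate {G : Set (Mat k n)} (hmul : ∀ a ∈ G, ∀ b ∈ G, a * b ∈ G)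
    {v : ι → MPoly k n} {g : ι → Mat k n} (hg : ∀ j, g j ∈ G) {h : Mat k n}
    {A : Matrix ι ι k}
    (hA : ∀ m ∈ G, ∀ i, mEval (h * m) (v i) = ∑ l, A i l * mEval m (v l))
    {m : Mat k n} (hm : m ∈ G) :
    mEval (h * m) (detTranslate v g) = A.det * mEval m (detTranslate v g) := by
  rw [mEval_detTranslate, mEval_detTranslate, ← Matrix.det_mul]
  congr 1
  ext i j
  simp only [Matrix.of_apply, Matrix.mul_apply]
  rw [mul_assoc, hA _ (hmul m hm _ (hg j))]

lemma exists_mEval_one_detTranslate_ne_zero {G : Set (Mat k n)} {v : ι → MPoly k n}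
    (hv : LinearIndependent k fun i => restrictTo G (v i)) :
    ∃ g : ι → Mat k n, (∀ j, g j ∈ G) ∧ mEval 1 (detTranslate v g) ≠ 0 := by
  obtain ⟨g, hg⟩ := exists_det_ne_zero hv
  refine ⟨fun j => (g j).1, fun j => (g j).2, ?_⟩
  simpa [mEval_detTranslate] using hg

/-- The determinant of an `H`-stable space of functions on `G` is an extendible character. -/
lemma exists_extendible_det {G H : Set (Mat k n)} (h1 : (1 : Mat k n) ∈ G)
    (hmul : ∀ a ∈ G, ∀ b ∈ G, a * b ∈ G) (hHG : H ⊆ G) {v : ι → MPoly k n}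
    (hv : LinearIndependent k fun i => restrictTo G (v i)) {A : Mat k n → Matrix ι ι k}
    (hA : ∀ h ∈ H, ∀ m ∈ G, ∀ i, mEval (h * m) (v i) = ∑ l, A h i l * mEval m (v l)) :
    ∃ δ : MPoly k n, IsCharacterOn H δ ∧ (∀ h ∈ H, mEval h δ = (A h).det) ∧
      Extendible G H δ := by
  obtain ⟨g, hg, hne⟩ := exists_mEval_one_detTranslate_ne_zero hv
  set D := detTranslate v g
  have hsemi : ∀ h ∈ H, ∀ m ∈ G, mEval (h * m) D = (A h).det * mEval m D :=
    fun h hh m hm => mEval_mul_detTranslate hmul hg (hA h hh) hm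
  have hdet : ∀ h ∈ H, mEval h (C (mEval 1 D)⁻¹ * D) = (A h).det := by
    intro h hh
    have := hsemi h hh 1 h1
    rw [mul_one] at this
    rw [mEval_mul, mEval_C, this]
    field_simp
  refine ⟨C (mEval 1 D)⁻¹ * D, ⟨?_, ?_⟩, hdet, D, fun h0 => hne (h0 1 h1), ?_⟩
  · rw [mEval_mul, mEval_C, inv_mul_cancel₀ hne]
  · intro a ha b hb
    simp only [hdet a ha, mEval_mul, mEval_C, hsemi a ha b (hHG hb)]
    ring
  · intro h hh m hm
    rw [hdet h hh, hsemi h hh m hm]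

/-- A finite dimensional space of polynomials contains a family which restricts to a basis
of its space of restrictions to `G`. -/
lemma exists_restrictTo_basis (G : Set (Mat k n)) {N : Submodule k (MPoly k n)} (hN : N.FG) :
    ∃ (r : ℕ) (v : Fin r → MPoly k n), (∀ i, v i ∈ N) ∧
      (LinearIndependent k fun i => restrictTo G (v i)) ∧
      ∀ q ∈ N, ∃ c : Fin r → k, ∀ m ∈ G, mEval m q = ∑ i, c i * mEval m (v i) := by
  have hfin : Module.Finite k (N.map (restrictTo G)) :=
    Module.Finite.iff_fg.2 (hN.map _)
  let b := Module.finBasis k (N.map (restrictTo G))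
  choose v hvN hvb using fun i => Submodule.mem_map.1 (b i).2
  refine ⟨_, v, hvN, ?_, fun q hq => ?_⟩
  · simp only [hvb]
    exact b.linearIndependent.map' (Submodule.subtype _) (Submodule.ker_subtype _)
  · let q' : N.map (restrictTo G) := ⟨restrictTo G q, Submodule.mem_map_of_mem hq⟩
    refine ⟨fun i => b.repr q' i, fun m hm => ?_⟩
    have hsum := congrArg (fun f : N.map (restrictTo G) => f.1 ⟨m, hm⟩) (b.sum_repr q')
    simp only [Submodule.coe_sum, Submodule.coe_smul, Finset.sum_apply, Pi.smul_apply,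
      ← hvb, restrictTo_apply, smul_eq_mul] at hsum
    exact hsum.symm

lemma exists_matrix_of_stable {G H : Set (Mat k n)} {N : Submodule k (MPoly k n)}
    {r : ℕ} {v : Fin r → MPoly k n} (hvN : ∀ i, v i ∈ N)
    (hspan : ∀ q ∈ N, ∃ c : Fin r → k, ∀ m ∈ G, mEval m q = ∑ i, c i * mEval m (v i))
    (hstab : ∀ h ∈ H, ∀ q ∈ N, leftTranslate h q ∈ N) :
    ∃ A : Mat k n → Matrix (Fin r) (Fin r) k,
      ∀ h ∈ H, ∀ m ∈ G, ∀ i, mEval (h * m) (v i) = ∑ l, A h i l * mEval m (v l) := by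
  have hrow : ∀ h i, ∃ c : Fin r → k,
      h ∈ H → ∀ m ∈ G, mEval (h * m) (v i) = ∑ l, c l * mEval m (v l) := by
    intro h i
    by_cases hh : h ∈ H
    · obtain ⟨c, hc⟩ := hspan _ (hstab h hh _ (hvN i))
      exact ⟨c, fun _ m hm => by rw [← hc m hm, mEval_leftTranslate]⟩
    · exact ⟨0, fun h' => absurd h' hh⟩
  choose c hc using hrow
  exact ⟨fun h => Matrix.of (c h), fun h hh m hm i => hc h i hh m hm⟩

end Determinants

section Characters

variable {k : Type} [Field k] {n : ℕ} {G H : Set (Mat k n)}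

lemma IsCharacterOn.ne_zero {χ : MPoly k n} (hχ : IsCharacterOn H χ) (hH : IsSubgroupOf H G)
    {h : Mat k n} (hh : h ∈ H) : mEval h χ ≠ 0 := by
  obtain ⟨b, hb, hab, -⟩ := hH.2.2.2 h hh
  intro h0
  have := hχ.map_mul h hh b hb
  rw [hab, hχ.map_one, h0, zero_mul] at this
  exact one_ne_zero this

lemma not_vanishesOn_mul (hG : IrreducibleSet G) {p q : MPoly k n} (hp : ¬ VanishesOn G p)
    (hq : ¬ VanishesOn G q) : ¬ VanishesOn G (p * q) :=
  fun h => (hG.2 p q h).elim hp hq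

lemma Extendible.mul (hG : IrreducibleSet G) {χ ψ : MPoly k n} (hχ : Extendible G H χ)
    (hψ : Extendible G H ψ) : Extendible G H (χ * ψ) := by
  obtain ⟨f, hf, hfs⟩ := hχ
  obtain ⟨f', hf', hfs'⟩ := hψ
  refine ⟨f * f', not_vanishesOn_mul hG hf hf', fun h hh m hm => ?_⟩
  rw [mEval_mul, hfs h hh m hm, hfs' h hh m hm, mEval_mul, mEval_mul]
  ring

lemma Extendible.congr {χ ψ : MPoly k n} (hχ : Extendible G H χ)
    (h : ∀ x ∈ H, mEval x χ = mEval x ψ) : Extendible G H ψ := by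
  obtain ⟨f, hf, hfs⟩ := hχ
  exact ⟨f, hf, fun x hx m hm => by rw [← h x hx, hfs x hx m hm]⟩

/-- A polynomial without zeros on a Zariski closed set is invertible there. -/
lemma ZClosed.exists_mul_eq_one [IsAlgClosed k] {Y : Set (Mat k n)} (hY : ZClosed Y)
    {p : MPoly k n} (hp : ∀ x ∈ Y, mEval x p ≠ 0) :
    ∃ q : MPoly k n, ∀ x ∈ Y, mEval x p * mEval x q = 1 := by
  obtain ⟨S, rfl⟩ := hY
  have htop : Ideal.span {p} ⊔ Ideal.span S = ⊤ := by
    by_contra hne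
    obtain ⟨M, hM, hle⟩ := Ideal.exists_le_maximal _ hne
    obtain ⟨x, hx⟩ := eq_vanishingIdeal_singleton_of_isMaximal k hM
    have hzero : ∀ q ∈ M, mEval (Matrix.of fun i j => x (i, j)) q = 0 := by
      intro q hq
      rw [hx, mem_vanishingIdeal_iff] at hq
      have := hq x rfl
      rwa [MvPolynomial.aeval_eq_eval] at this
    refine hp (Matrix.of fun i j => x (i, j)) (fun q hq => hzero q ?_) (hzero p ?_)
    · exact hle (Ideal.mem_sup_right (Ideal.subset_span hq))
    · exact hle (Ideal.mem_sup_left (Ideal.subset_span rfl))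
  obtain ⟨a, ha, b, hb, hab⟩ := Submodule.mem_sup.1 ((Ideal.eq_top_iff_one _).1 htop)
  obtain ⟨q, rfl⟩ := Ideal.mem_span_singleton.1 ha
  refine ⟨q, fun x hx => ?_⟩
  have hle : Ideal.span S ≤ RingHom.ker (eval fun ij : Fin n × Fin n => x ij.1 ij.2) :=
    Ideal.span_le.2 hx
  have hbx : mEval x b = 0 := hle hb
  rw [← mEval_mul, ← mEval_one x, ← hab, mEval_add, hbx, add_zero]

lemma zClosed_of_isClosedIn (hG : ZClosed G) (hH : IsClosedIn H G) : ZClosed H := by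
  obtain ⟨S, hS⟩ := hG
  obtain ⟨-, _, ⟨T, rfl⟩, rfl⟩ := hH
  refine ⟨T ∪ S, ?_⟩
  ext x
  rw [hS]
  simp [or_imp, forall_and]

lemma IsCharacterOn.exists_inv [IsAlgClosed k] (hHz : ZClosed H) (hH : IsSubgroupOf H G)
    {χ : MPoly k n} (hχ : IsCharacterOn H χ) :
    ∃ χ' : MPoly k n, IsCharacterOn H χ' ∧ ∀ h ∈ H, mEval h χ * mEval h χ' = 1 := by
  obtain ⟨q, hq⟩ := hHz.exists_mul_eq_one fun x hx => hχ.ne_zero hH hx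
  refine ⟨q, ⟨?_, fun a ha b hb => ?_⟩, hq⟩
  · have := hq 1 hH.2.1
    rwa [hχ.map_one, one_mul] at this
  · have hab := hq _ (hH.2.2.1 a ha b hb)
    have hne := hχ.ne_zero hH (hH.2.2.1 a ha b hb)
    refine mul_left_cancel₀ hne ?_
    rw [hab, hχ.map_mul a ha b hb]
    linear_combination -(mEval b χ * mEval b q) * hq a ha - hq b hb

lemma detTranslate_mem {ι : Type*} [Fintype ι] [DecidableEq ι] {J : Ideal (MPoly k n)}
    {v : ι → MPoly k n} {g : ι → Mat k n} (j : ι) (h : ∀ i, rightTranslate (g j) (v i) ∈ J) :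
    detTranslate v g ∈ J := by
  rw [detTranslate, Matrix.det_apply']
  refine Ideal.sum_mem _ fun σ _ => Ideal.mul_mem_left _ _ ?_
  refine Ideal.mem_of_dvd J (Finset.dvd_prod_of_mem _ (Finset.mem_univ j)) ?_
  exact h (σ j)

/-- A nonzero `H`-stable ideal contains a nonzero semiinvariant whose weight is an extendible
character. -/
lemma exists_semiinvariant_mem (hG : IsAlgGroup G) (hH : IsSubgroupOf H G)
    {J : Ideal (MPoly k n)} (hJG : ∀ p : MPoly k n, VanishesOn G p → p ∈ J)
    (hJH : ∀ p ∈ J, ∀ h ∈ H, ∃ p' ∈ J, ∀ m ∈ G, mEval m p' = mEval (h * m) p)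
    (hJ : ∃ p ∈ J, ¬ VanishesOn G p) :
    ∃ δ : MPoly k n, IsCharacterOn H δ ∧ Extendible G H δ ∧
      ∃ f ∈ J, ¬ VanishesOn G f ∧
        ∀ h ∈ H, ∀ m ∈ G, mEval (h * m) f = mEval h δ * mEval m f := by
  obtain ⟨p, hpJ, hp⟩ := hJ
  have hmemJ : ∀ q q' : MPoly k n, q' ∈ J → (∀ m ∈ G, mEval m q = mEval m q') → q ∈ J := by
    intro q q' hq' h
    rw [← sub_add_cancel q q']
    exact J.add_mem (hJG _ fun m hm => by rw [mEval_sub, h m hm, sub_self]) hq'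
  have hle : translateSpan H p ≤ J.restrictScalars k := by
    refine Submodule.span_le.2 ?_
    rintro _ ⟨a, ha, rfl⟩
    obtain ⟨p', hp', heq⟩ := hJH p hpJ a ha
    exact hmemJ _ p' hp' fun m hm => by rw [heq m hm, mEval_leftTranslate]
  obtain ⟨r, v, hvN, hv, hspan⟩ := exists_restrictTo_basis G (translateSpan_fg H p)
  obtain ⟨A, hA⟩ := exists_matrix_of_stable (H := H) hvN hspan
    fun h hh q hq => leftTranslate_mem_translateSpan hH.2.2.1 hh hq
  obtain ⟨δ, hδ, hδdet, hδext⟩ := exists_extendible_det hG.2.1 hG.2.2.1 hH.1 hv hA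
  obtain ⟨g, hg, hne⟩ := exists_mEval_one_detTranslate_ne_zero hv
  have hr : Nonempty (Fin r) := by
    by_contra hempty
    rw [not_nonempty_iff] at hempty
    obtain ⟨c, hc⟩ := hspan p (mem_translateSpan_self hH.2.1 p)
    exact hp fun m hm => by simp [hc m hm]
  obtain ⟨j⟩ := hr
  obtain ⟨b, hb, hgb, hbg⟩ := hG.2.2.2 (g j) (hg j)
  refine ⟨δ, hδ, hδext, detTranslate v fun i => b * g i, ?_, fun h0 => hne ?_, ?_⟩
  · refine detTranslate_mem j fun i => hmemJ _ (v i) (hle (hvN i)) fun m hm => ?_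
    rw [mEval_rightTranslate, hbg, mul_one]
  · have := h0 (g j) (hg j)
    simpa [mEval_detTranslate, ← mul_assoc, hgb] using this
  · intro h hh m hm
    rw [hδdet h hh]
    exact mEval_mul_detTranslate hG.2.2.1 (fun i => hG.2.2.1 b hb _ (hg i)) (hA h hh) hm

/-- Every character of `H` is a quotient of two extendible characters. -/
lemma IsCharacterOn.exists_extendible_mul (hG : IsAlgGroup G) (hH : IsSubgroupOf H G)
    {χ : MPoly k n} (hχ : IsCharacterOn H χ) :
    ∃ δ : MPoly k n, IsCharacterOn H δ ∧ Extendible G H δ ∧ Extendible G H (χ * δ) := by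
  have hres : ∀ q ∈ translateSpan H χ, ∀ a ∈ H, mEval a q = mEval a χ * mEval 1 q := by
    intro q hq a ha
    induction hq using Submodule.span_induction with
    | mem q hq =>
      obtain ⟨b, hb, rfl⟩ := hq
      simp only [mEval_leftTranslate, mul_one]
      rw [hχ.map_mul b hb a ha, mul_comm]
    | zero => simp [mEval]
    | add p q _ _ hp hq => rw [mEval_add, mEval_add, hp, hq, mul_add]
    | smul c q _ hq => rw [mEval_smul, mEval_smul, hq]; ring
  let N : Submodule k (MPoly k n) := translateSpan H χ ⊓ LinearMap.ker (evalLinear 1)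
  have hNfg : N.FG := by
    have : Module.Finite k (translateSpan H χ) := Module.Finite.iff_fg.2 (translateSpan_fg H χ)
    exact Module.Finite.iff_fg.1 (Submodule.finiteDimensional_of_le inf_le_left)
  have hNstab : ∀ h ∈ H, ∀ q ∈ N, leftTranslate h q ∈ N := by
    rintro h hh q ⟨hq, hq1⟩
    refine ⟨leftTranslate_mem_translateSpan hH.2.2.1 hh hq, ?_⟩
    have hq1' : mEval 1 q = 0 := hq1
    change mEval 1 (leftTranslate h q) = 0
    rw [mEval_leftTranslate, mul_one, hres q hq h hh, hq1', mul_zero]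
  obtain ⟨r, v, hvN, hv, hspan⟩ := exists_restrictTo_basis G hNfg
  obtain ⟨A, hA⟩ := exists_matrix_of_stable hvN hspan hNstab
  obtain ⟨δ, hδ, hδdet, hδext⟩ := exists_extendible_det hG.2.1 hG.2.2.1 hH.1 hv hA
  have hrow : ∀ h, ∃ c : Fin r → k, h ∈ H →
      ∀ m ∈ G, mEval (h * m) χ = mEval h χ * mEval m χ + ∑ i, c i * mEval m (v i) := by
    intro h
    by_cases hh : h ∈ H
    · have hmem : leftTranslate h χ - mEval h χ • χ ∈ N := by
        refine ⟨Submodule.sub_mem _ (Submodule.subset_span ⟨h, hh, rfl⟩)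
          (Submodule.smul_mem _ _ (mem_translateSpan_self hH.2.1 χ)), ?_⟩
        simp [hχ.map_one]
      obtain ⟨c, hc⟩ := hspan _ hmem
      refine ⟨c, fun _ m hm => ?_⟩
      rw [← hc m hm, mEval_sub, mEval_smul, mEval_leftTranslate]
      ring
    · exact ⟨0, fun h' => absurd h' hh⟩
  choose c hc using hrow
  let w : Unit ⊕ Fin r → MPoly k n := Sum.elim (fun _ => χ) v
  have hw : LinearIndependent k fun i => restrictTo G (w i) := by
    have hv1 : ∀ i, mEval 1 (v i) = 0 := fun i => (hvN i).2
    rw [Fintype.linearIndependent_iff] at hv ⊢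
    intro a ha
    simp only [Fintype.sum_sum_type, Finset.univ_unique, Finset.sum_singleton, w,
      Sum.elim_inl, Sum.elim_inr] at ha
    have h0 : a (Sum.inl default) = 0 := by
      have := congrFun ha ⟨1, hG.2.1⟩
      simpa [hχ.map_one, hv1] using this
    rw [h0, zero_smul, zero_add] at ha
    rintro (i | i)
    · exact h0
    · exact hv _ ha i
  obtain ⟨ε, -, hεdet, hεext⟩ := exists_extendible_det (H := H) hG.2.1 hG.2.2.1 hH.1 hw
    (A := fun h => Matrix.fromBlocks (Matrix.of fun _ _ => mEval h χ)
      (Matrix.of fun _ j => c h j) 0 (A h)) (by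
      rintro h hh m hm (i | i)
      · simp [w, hc h hh m hm]
      · simp [w, hA h hh m hm i])
  refine ⟨δ, hδ, hδext, hεext.congr fun h hh => ?_⟩
  rw [hεdet h hh, Matrix.det_fromBlocks_zero₂₁, mEval_mul, hδdet h hh]
  simp

end Characters

section Observability

variable {k : Type} [Field k] {n : ℕ} {G H : Set (Mat k n)}

/-- In the observable case, the inverse of an extendible character is extendible. -/
lemma LeftObservable.extendible_inv (hobs : LeftObservable H G) (hGconn : IrreducibleSet G)
    (hmul : ∀ a ∈ G, ∀ b ∈ G, a * b ∈ G) (hHG : H ⊆ G)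
    {χ χ' : MPoly k n} (hinv : ∀ h ∈ H, mEval h χ * mEval h χ' = 1)
    (hχ : Extendible G H χ) : Extendible G H χ' := by
  obtain ⟨f, hf, hfs⟩ := hχ
  let J : Ideal (MPoly k n) :=
    { carrier := {p | ∃ q : MPoly k n, ∀ m ∈ G, mEval m p = mEval m f * mEval m q}
      zero_mem' := ⟨0, fun m _ => by simp [mEval]⟩
      add_mem' := by
        rintro p p' ⟨q, hq⟩ ⟨q', hq'⟩
        exact ⟨q + q', fun m hm => by rw [mEval_add, hq m hm, hq' m hm, mEval_add, mul_add]⟩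
      smul_mem' := by
        rintro c p ⟨q, hq⟩
        exact ⟨c * q, fun m hm => by rw [smul_eq_mul, mEval_mul, hq m hm, mEval_mul]; ring⟩ }
  obtain ⟨p, ⟨q, hq⟩, hp, hpinv⟩ := hobs J
    (fun p hp => ⟨0, fun m hm => by rw [hp m hm]; simp [mEval]⟩)
    (by
      rintro p ⟨q, hq⟩ h hh
      refine ⟨leftTranslate h p, ⟨C (mEval h χ) * leftTranslate h q, fun m hm => ?_⟩,
        fun m _ => mEval_leftTranslate h m p⟩
      rw [mEval_leftTranslate, hq _ (hmul h (hHG hh) m hm), hfs h hh m hm, mEval_mul, mEval_C,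
        mEval_leftTranslate]
      ring)
    ⟨f, ⟨1, fun m _ => by rw [mEval_one, mul_one]⟩, hf⟩
  refine ⟨q, fun hq0 => hp fun m hm => by rw [hq m hm, hq0 m hm, mul_zero], fun h hh m hm => ?_⟩
  have key : VanishesOn G (f * (leftTranslate h q - C (mEval h χ') * q)) := by
    intro x hx
    have hx' := hpinv h hh x hx
    rw [hq _ (hmul h (hHG hh) x hx), hq x hx, hfs h hh x hx] at hx'
    rw [mEval_mul, mEval_sub, mEval_mul, mEval_C, mEval_leftTranslate]
    linear_combination mEval h χ' * hx' - mEval x f * mEval (h * x) q * hinv h hh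
  have := (hGconn.2 _ _ key).resolve_left hf m hm
  rw [mEval_sub, mEval_mul, mEval_C, mEval_leftTranslate] at this
  exact sub_eq_zero.1 this

end Observability

/-- Let `G` be a connected affine algebraic group and `H ⊆ G` a closed
subgroup.  The following are equivalent: (1) `H` is observable in `G`;
(2) `E_G(H) = X(H)`, i.e. every rational character of `H` extends to a semiinvariant
regular function on `G`; (3) `E_G(H)` is a group, i.e. for every extendible character
`χ ∈ E_G(H)` its inverse `χ⁻¹` is also extendible. -/
theorem observable_iff_characters_extend_iff_extendible_group
    {k : Type} [Field k] [IsAlgClosed k] {n : ℕ}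
    (G H : Set (Mat k n)) (hG : IsAlgGroup G) (hGconn : IrreducibleSet G)
    (hH : IsSubgroupOf H G) (hHcl : IsClosedIn H G) :
    (LeftObservable H G ↔
      ∀ χ : MPoly k n, IsCharacterOn H χ → Extendible G H χ) ∧
    (LeftObservable H G ↔
      ∀ χ : MPoly k n, IsCharacterOn H χ → Extendible G H χ →
        ∃ χ' : MPoly k n, IsCharacterOn H χ' ∧
          (∀ h ∈ H, mEval h χ * mEval h χ' = 1) ∧ Extendible G H χ') := by
  have hHz : ZClosed H := zClosed_of_isClosedIn hG.1 hHcl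
  have observable_to_group : LeftObservable H G →
      ∀ χ : MPoly k n, IsCharacterOn H χ → Extendible G H χ →
        ∃ χ' : MPoly k n, IsCharacterOn H χ' ∧
          (∀ h ∈ H, mEval h χ * mEval h χ' = 1) ∧ Extendible G H χ' := by
    intro hobs χ hχ hext
    obtain ⟨χ', hχ', hinv⟩ := hχ.exists_inv hHz hH
    exact ⟨χ', hχ', hinv, hobs.extendible_inv hGconn hG.2.2.1 hH.1 hinv hext⟩
  have group_to_observable : (∀ χ : MPoly k n, IsCharacterOn H χ → Extendible G H χ →
        ∃ χ' : MPoly k n, IsCharacterOn H χ' ∧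
          (∀ h ∈ H, mEval h χ * mEval h χ' = 1) ∧ Extendible G H χ') →
      LeftObservable H G := by
    intro hgrp J hJG hJH hJ
    obtain ⟨δ, hδ, hδext, f, hfJ, hf, hfs⟩ := exists_semiinvariant_mem hG hH hJG hJH hJ
    obtain ⟨δ', -, hinv, f', hf', hfs'⟩ := hgrp δ hδ hδext
    refine ⟨f * f', J.mul_mem_right _ hfJ, not_vanishesOn_mul hGconn hf hf', ?_⟩
    intro h hh m hm
    rw [mEval_mul, hfs h hh m hm, hfs' h hh m hm, mEval_mul]
    linear_combination mEval m f * mEval m f' * hinv h hh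
  refine ⟨⟨fun hobs χ hχ => ?_, fun hall => group_to_observable fun χ hχ _ => ?_⟩,
    observable_to_group, group_to_observable⟩
  · obtain ⟨δ, hδ, hδext, hmul⟩ := hχ.exists_extendible_mul hG hH
    obtain ⟨δ', -, hinv, hδ'⟩ := observable_to_group hobs δ hδ hδext
    refine (hmul.mul hGconn hδ').congr fun h hh => ?_
    rw [mEval_mul, mEval_mul, mul_assoc, hinv h hh, mul_one]
  · obtain ⟨χ', hχ', hinv⟩ := hχ.exists_inv hHz hH
    exact ⟨χ', hχ', hinv, hall χ' hχ'⟩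

end AlgebraicMonoid
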